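/- Let k be a positive integer and let m, n be positive integers with n | m. Then Φ_k(n) | Φ_k(m). -/

import Mathlib

/-- `Phi k n` is the number of `k`-tuples `(x_1,…,x_k) ∈ (ℤ/nℤ)^k`
with `gcd(x_1² + ⋯ + x_k², n) = 1`. -/
noncomputable def Phi (k n : ℕ) : ℕ :=
  Nat.card {x : Fin k → ZMod n // Nat.gcd (∑ i, (x i) ^ 2 : ZMod n).val n = 1}

theorem ZMod.gcd_val_eq_one_iff_isUnit {n : ℕ} (hn : n ≠ 0) (a : ZMod n) :
    Nat.gcd a.val n = 1 ↔ IsUnit a := by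
  have : NeZero n := ⟨hn⟩
  rw [← Nat.coprime_iff_gcd_eq_one, ← ZMod.isUnit_iff_coprime, ZMod.natCast_zmod_val]

theorem Phi_eq_card_isUnit (k : ℕ) {n : ℕ} (hn : n ≠ 0) :
    Phi k n = Nat.card {x : Fin k → ZMod n // IsUnit (∑ i, x i ^ 2)} :=
  Nat.card_congr (Equiv.subtypeEquivRight fun _ => ZMod.gcd_val_eq_one_iff_isUnit hn _)

theorem Phi_mul_of_coprime (k : ℕ) {m n : ℕ} (hm : m ≠ 0) (hn : n ≠ 0) (h : m.Coprime n) :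
    Phi k (m * n) = Phi k m * Phi k n := by
  rw [Phi_eq_card_isUnit k (mul_ne_zero hm hn), Phi_eq_card_isUnit k hm,
    Phi_eq_card_isUnit k hn, ← Nat.card_prod]
  let e := ZMod.chineseRemainder h
  let E : (Fin k → ZMod (m * n)) ≃ (Fin k → ZMod m) × (Fin k → ZMod n) :=
    (Equiv.arrowCongr (Equiv.refl _) e.toEquiv).trans (Equiv.arrowProdEquivProdArrow _ _ _)
  refine Nat.card_congr ((Equiv.subtypeEquiv E fun x => ?_).trans
    (Equiv.subtypeProdEquivProd (p := fun x : Fin k → ZMod m => IsUnit (∑ i, x i ^ 2))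
      (q := fun x : Fin k → ZMod n => IsUnit (∑ i, x i ^ 2))))
  rw [← MulEquiv.isUnit_map e, Prod.isUnit_iff, map_sum, Prod.fst_sum, Prod.snd_sum]
  simp [E, Equiv.arrowProdEquivProdArrow, Equiv.arrowCongr]

theorem AddMonoidHom.card_subtype_dvd_card_subtype_comp {G H : Type*} [AddGroup G] [AddGroup H]
    (f : G →+ H) (hf : Function.Surjective f) (P : H → Prop) :
    Nat.card {y // P y} ∣ Nat.card {x // P (f x)} := by
  have e (y : H) : {x // f x = y} ≃ f.ker :=
    (Equiv.addLeft (-(hf y).choose)).subtypeEquiv fun x => by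
      rw [AddMonoidHom.mem_ker, Equiv.coe_addLeft, map_add, map_neg, (hf y).choose_spec,
        neg_add_eq_zero, eq_comm]
  have E : {x // P (f x)} ≃ {y // P y} × f.ker :=
    (Equiv.sigmaSubtypeFiberEquivSubtype f fun _ => Iff.rfl).symm.trans
      ((Equiv.sigmaCongrRight fun y : Subtype P => e y).trans (Equiv.sigmaEquivProd _ _))
  rw [Nat.card_congr E, Nat.card_prod]
  exact dvd_mul_right _ _

theorem ZMod.isUnit_castHom_mul_iff {n d : ℕ} (hn : n ≠ 0) (hdn : d ∣ n) (hd : d ≠ 0)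
    (a : ZMod (n * d)) :
    IsUnit (ZMod.castHom (dvd_mul_right n d) (ZMod n) a) ↔ IsUnit a := by
  have : NeZero (n * d) := ⟨mul_ne_zero hn hd⟩
  rw [← ZMod.natCast_zmod_val a, map_natCast, ZMod.isUnit_iff_coprime, ZMod.isUnit_iff_coprime,
    Nat.coprime_mul_iff_right]
  exact ⟨fun h => ⟨h, h.coprime_dvd_right hdn⟩, And.left⟩

theorem Phi_dvd_Phi_mul_of_dvd (k : ℕ) {n d : ℕ} (hn : n ≠ 0) (hd : d ≠ 0) (hdn : d ∣ n) :
    Phi k n ∣ Phi k (n * d) := by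
  have : NeZero (n * d) := ⟨mul_ne_zero hn hd⟩
  let c := ZMod.castHom (dvd_mul_right n d) (ZMod n)
  have hf : Function.Surjective (c.toAddMonoidHom.compLeft (Fin k)) :=
    (ZMod.castHom_surjective (dvd_mul_right n d)).comp_left
  rw [Phi_eq_card_isUnit k hn, Phi_eq_card_isUnit k (mul_ne_zero hn hd)]
  refine (AddMonoidHom.card_subtype_dvd_card_subtype_comp _ hf
    fun y => IsUnit (∑ i, y i ^ 2)).trans
      (Nat.card_congr (Equiv.subtypeEquivRight fun x => ?_)).dvd
  rw [← ZMod.isUnit_castHom_mul_iff hn hdn hd, map_sum]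
  simp [c]

theorem Phi_dvd_Phi_mul (k d : ℕ) (hd : d ≠ 0) : ∀ n ≠ 0, Phi k n ∣ Phi k (n * d) := by
  induction d using induction_on_primes with
  | zero => exact absurd rfl hd
  | one => simp
  | prime_mul p a hp ih =>
    intro n hn
    rw [← mul_assoc]
    refine dvd_trans ?_ (ih (right_ne_zero_of_mul hd) _ (mul_ne_zero hn hp.ne_zero))
    by_cases hpn : p ∣ n
    · exact Phi_dvd_Phi_mul_of_dvd k hn hp.ne_zero hpn
    · rw [Phi_mul_of_coprime k hn hp.ne_zero ((hp.coprime_iff_not_dvd.2 hpn).symm)]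
      exact dvd_mul_right _ _

theorem Phi_dvd (k : ℕ) (hk : 0 < k) (m n : ℕ) (hm : 0 < m) (hn : 0 < n)
    (hdvd : n ∣ m) : Phi k n ∣ Phi k m := by
  obtain ⟨d, rfl⟩ := hdvd
  exact Phi_dvd_Phi_mul k d (right_ne_zero_of_mul hm.ne') n hn.ne'
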